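/- Proposition: For all A, B ∈ ARI(Γ), one has the identity of linear endomorphisms of ARI(Γ): arit_u(B)∘arit_u(A) − arit_u(A)∘arit_u(B) = arit_u(ari_u(A,B)); that is, for every C ∈ ARI(Γ), arit_u(B)(arit_u(A)(C)) − arit_u(A)(arit_u(B)(C)) = arit_u(ari_u(A,B))(C). -/

import Mathlib

namespace KVMould

/-- A mould over `Γ` in evaluation form: the depth-`m` component
`M m σ x` is the value of the rational function `M^m_{σ₁,…,σₘ}` at the
rational point `x = (x₁,…,xₘ)` (indices are 0-based). -/
abbrev Mould (Γ : Type) : Type := (m : ℕ) → (Fin m → Γ) → (Fin m → ℚ) → ℚ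

variable {Γ : Type} [CommGroup Γ]

/-- `M ∈ ARI(Γ)`: the depth `0` component vanishes. -/
def IsARI (M : Mould Γ) : Prop := ∀ σ x, M 0 σ x = 0

/-- Extension of a tuple of rationals by `0` outside the range. -/
def extQ {m : ℕ} (x : Fin m → ℚ) : ℕ → ℚ := fun i => if h : i < m then x ⟨i, h⟩ else 0

/-- Extension of a tuple of group elements by `1` outside the range. -/
def extG {m : ℕ} (σ : Fin m → Γ) : ℕ → Γ := fun i => if h : i < m then σ ⟨i, h⟩ else 1

/-- The (noncommutative, nonunital on `ARI`) mould product `A × B`. -/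
def mouldMul (A B : Mould Γ) : Mould Γ := fun m σ x =>
  ∑ k ∈ Finset.range (m + 1),
    A k (fun j => extG σ j.val) (fun j => extQ x j.val) *
      B (m - k) (fun j => extG σ (k + j.val)) (fun j => extQ x (k + j.val))

/-- Ecalle's derivation `arit_u(B)(A)` (0-indexed form of the paper's
Definition of `arit_u`; the blocks `k ≤ l` below are 0-based). -/
def aritU (B A : Mould Γ) : Mould Γ := fun m σ x =>
  (∑ k ∈ Finset.range m, ∑ l ∈ Finset.range m,
    if k ≤ l ∧ l + 1 < m then
      A (m - (l - k + 1))
        (fun j => if j.val < k then extG σ j.val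
          else if j.val = k then extG σ (l + 1)
          else extG σ (j.val + (l - k + 1)))
        (fun j => if j.val < k then extQ x j.val
          else if j.val = k then ∑ i ∈ Finset.Icc k (l + 1), extQ x i
          else extQ x (j.val + (l - k + 1))) *
      B (l - k + 1)
        (fun j => extG σ (k + j.val) * (extG σ (l + 1))⁻¹)
        (fun j => extQ x (k + j.val))
    else 0)
  -
  (∑ k ∈ Finset.range m, ∑ l ∈ Finset.range m,
    if 1 ≤ k ∧ k ≤ l then
      A (m - (l - k + 1))
        (fun j => if j.val < k - 1 then extG σ j.val
          else if j.val = k - 1 then extG σ (k - 1)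
          else extG σ (j.val + (l - k + 1)))
        (fun j => if j.val < k - 1 then extQ x j.val
          else if j.val = k - 1 then ∑ i ∈ Finset.Icc (k - 1) l, extQ x i
          else extQ x (j.val + (l - k + 1))) *
      B (l - k + 1)
        (fun j => extG σ (k + j.val) * (extG σ (k - 1))⁻¹)
        (fun j => extQ x (k + j.val))
    else 0)

/-- The `ari_u`-bracket: `ari_u(A,B) = arit_u(B)(A) − arit_u(A)(B) + A×B − B×A`. -/
def ariU (A B : Mould Γ) : Mould Γ :=
  aritU B A - aritU A B + mouldMul A B - mouldMul B A

/-- `preari_u(A,B) = arit_u(B)(A) + A×B`. -/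
def preariU (A B : Mould Γ) : Mould Γ := aritU B A + mouldMul A B

/-- The set of shuffle permutations `Sh(p,q)`. -/
def shuffles (p q : ℕ) : Finset (Equiv.Perm (Fin (p + q))) :=
  Finset.univ.filter fun τ =>
    (∀ i j : Fin (p + q), i.val < j.val → j.val < p → τ⁻¹ i < τ⁻¹ j) ∧
    (∀ i j : Fin (p + q), i.val < j.val → p ≤ i.val → τ⁻¹ i < τ⁻¹ j)

/-- Alternality of a mould. -/
def IsAlternal (M : Mould Γ) : Prop :=
  ∀ p q : ℕ, 1 ≤ p → 1 ≤ q → ∀ (σ : Fin (p + q) → Γ) (x : Fin (p + q) → ℚ),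
    ∑ τ ∈ shuffles p q, M (p + q) (fun i => σ (τ i)) (fun i => x (τ i)) = 0

/-- The `swap` of a mould. -/
def swapM (M : Mould Γ) : Mould Γ := fun m σ v =>
  M m (fun i => ∏ j ∈ Finset.range (m - i.val), extG σ j)
    (fun i => extQ v (m - 1 - i.val) - extQ v (m - i.val))

/-- Bialternality: `M` and `swap(M)` are alternal and the depth `1`
component is even (`M¹(x₁;σ₁) = M¹(−x₁;σ₁⁻¹)`). -/
def IsBialternal (M : Mould Γ) : Prop :=
  IsAlternal M ∧ IsAlternal (swapM M) ∧
    ∀ (σ : Γ) (t : ℚ), M 1 (fun _ => σ) (fun _ => t) = M 1 (fun _ => σ⁻¹) (fun _ => -t)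

/-- The `push` operator. -/
def pushM (M : Mould Γ) : Mould Γ := fun m σ x =>
  M m
    (fun i => if i.val = 0 then (extG σ (m - 1))⁻¹
      else extG σ (i.val - 1) * (extG σ (m - 1))⁻¹)
    (fun i => if i.val = 0 then -(∑ j ∈ Finset.range m, extQ x j)
      else extQ x (i.val - 1))

/-- The `v`-variant `arit_v(B)(A)`. -/
def aritV (B A : Mould Γ) : Mould Γ := fun m σ v =>
  (∑ k ∈ Finset.range m, ∑ l ∈ Finset.range m,
    if k ≤ l ∧ l + 1 < m then
      A (m - (l - k + 1))
        (fun j => if j.val < k then extG σ j.val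
          else if j.val = k then ∏ i ∈ Finset.Icc k (l + 1), extG σ i
          else extG σ (j.val + (l - k + 1)))
        (fun j => if j.val < k then extQ v j.val
          else if j.val = k then extQ v (l + 1)
          else extQ v (j.val + (l - k + 1))) *
      B (l - k + 1)
        (fun j => extG σ (k + j.val))
        (fun j => extQ v (k + j.val) - extQ v (l + 1))
    else 0)
  -
  (∑ k ∈ Finset.range m, ∑ l ∈ Finset.range m,
    if 1 ≤ k ∧ k ≤ l then
      A (m - (l - k + 1))
        (fun j => if j.val < k - 1 then extG σ j.val
          else if j.val = k - 1 then ∏ i ∈ Finset.Icc (k - 1) l, extG σ i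
          else extG σ (j.val + (l - k + 1)))
        (fun j => if j.val < k - 1 then extQ v j.val
          else if j.val = k - 1 then extQ v (k - 1)
          else extQ v (j.val + (l - k + 1))) *
      B (l - k + 1)
        (fun j => extG σ (k + j.val))
        (fun j => extQ v (k + j.val) - extQ v (k - 1))
    else 0)

/-- The `ari_v`-bracket. -/
def ariV (A B : Mould Γ) : Mould Γ :=
  aritV B A - aritV A B + mouldMul A B - mouldMul B A

/-- Pus-neutrality: all cyclic shifts of every component sum to zero. -/
def IsPusNeutral (N : Mould Γ) : Prop :=
  ∀ m : ℕ, 1 ≤ m → ∀ (σ : Fin m → Γ) (v : Fin m → ℚ),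
    ∑ i ∈ Finset.range m,
      N m (fun j => extG σ ((i + j.val) % m)) (fun j => extQ v ((i + j.val) % m)) = 0

/-- The subgroup `Γ^N = {g^N : g ∈ Γ}`. -/
def powSubgroup (Γ : Type) [CommGroup Γ] (N : ℕ) : Subgroup Γ :=
  MonoidHom.range (powMonoidHom N)

/-- The map `i_N : ARI(Γ) → ARI(Γ^N)` (restriction of indices). -/
def iN (N : ℕ) (M : Mould Γ) : Mould (powSubgroup Γ N) := fun m σ x =>
  M m (fun i => (σ i : Γ)) x

/-- The map `m_N : ARI(Γ) → ARI(Γ^N)`. -/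
def mN [Fintype Γ] [DecidableEq Γ] (N : ℕ) (M : Mould Γ) :
    Mould (powSubgroup Γ N) := fun m σ x =>
  ∑ τ ∈ Finset.univ.filter (fun τ : Fin m → Γ => ∀ i, τ i ^ N = (σ i : Γ)),
    M m τ (fun i => (N : ℚ) * x i)

/-- `M` satisfies the distribution relations. -/
def IsARID [Fintype Γ] [DecidableEq Γ] (M : Mould Γ) : Prop :=
  ∀ N : ℕ, 1 ≤ N → N ∣ Fintype.card Γ → iN N M = mN N M

/-- The parallel translation map `t`. -/
def tMap (P : Mould Γ) : Mould Γ := fun m σ v =>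
  if m ≤ 1 then P m σ v
  else P (m - 1) (fun j => extG σ (j.val + 1)) (fun j => extQ v (j.val + 1) - extQ v 0)

/-- `ũ := t ∘ swap`. -/
def uTilde (M : Mould Γ) : Mould Γ := tMap (swapM M)


/-! ### Sums over factorizations of a word -/

/-- The sum of `G u c` over all factorizations `w = u ++ c`. -/
def conv {α : Type} (G : List α → List α → ℚ) (w : List α) : ℚ :=
  ∑ k ∈ Finset.range (w.length + 1), G (w.take k) (w.drop k)

section Conv

variable {α β : Type}

@[simp] lemma conv_nil (G : List α → List α → ℚ) : conv G [] = G [] [] := by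
  simp [conv]

lemma conv_cons (G : List α → List α → ℚ) (a : α) (w : List α) :
    conv G (a :: w) = G [] (a :: w) + conv (fun u c => G (a :: u) c) w := by
  simp only [conv, List.length_cons]
  rw [Finset.sum_range_succ', add_comm]
  simp

lemma conv_congr {G H : List α → List α → ℚ} {w : List α}
    (h : ∀ u c, u ++ c = w → G u c = H u c) : conv G w = conv H w :=
  Finset.sum_congr rfl fun _ _ => h _ _ (List.take_append_drop _ _)

lemma conv_add (G H : List α → List α → ℚ) (w : List α) :
    conv (fun u c => G u c + H u c) w = conv G w + conv H w :=
  Finset.sum_add_distrib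

lemma conv_sub (G H : List α → List α → ℚ) (w : List α) :
    conv (fun u c => G u c - H u c) w = conv G w - conv H w :=
  Finset.sum_sub_distrib _ _

lemma conv_mul_left (r : ℚ) (G : List α → List α → ℚ) (w : List α) :
    conv (fun u c => r * G u c) w = r * conv G w :=
  (Finset.mul_sum _ _ _).symm

lemma conv_zero (w : List α) : conv (fun _ _ => 0) w = 0 :=
  Finset.sum_const_zero

lemma conv_comm (K : List α → List α → List β → List β → ℚ) (v : List α) (w : List β) :
    conv (fun x y => conv (K x y) w) v = conv (fun u c => conv (fun x y => K x y u c) v) w :=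
  Finset.sum_comm

lemma conv_map (f : α → β) (G : List β → List β → ℚ) (w : List α) :
    conv G (w.map f) = conv (fun u c => G (u.map f) (c.map f)) w := by
  simp [conv, List.map_take, List.map_drop]

lemma conv_assoc (H : List α → List α → List α → ℚ) (w : List α) :
    conv (fun u c => conv (fun x y => H x y c) u) w =
      conv (fun x r => conv (fun y c => H x y c) r) w := by
  induction w generalizing H with
  | nil => simp
  | cons a w ih =>
    simp only [conv_cons, conv_nil, conv_add]
    rw [ih fun x => H (a :: x)]
    ring

lemma conv_nil_right (G : List α → ℚ) (w : List α) :
    conv (fun u c => if c = [] then G u else 0) w = G w := by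
  induction w generalizing G with
  | nil => simp
  | cons a w ih => simp [conv_cons, ih fun u => G (a :: u)]

/-- The function on words which is `k` on one-letter words and vanishes on all others. -/
def one (k : α → ℚ) : List α → ℚ
  | [s] => k s
  | _ => 0

@[simp] lemma one_nil (k : α → ℚ) : one k [] = 0 := rfl

@[simp] lemma one_singleton (k : α → ℚ) (s : α) : one k [s] = k s := rfl

@[simp] lemma one_cons_cons (k : α → ℚ) (s t : α) (w : List α) : one k (s :: t :: w) = 0 := rfl

lemma one_congr {k k' : α → ℚ} (h : ∀ s, k s = k' s) (w : List α) : one k w = one k' w := by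
  rw [funext h]

lemma one_add (k k' : α → ℚ) (w : List α) :
    one (fun s => k s + k' s) w = one k w + one k' w := by
  rcases w with _ | ⟨s, _ | ⟨t, w⟩⟩ <;> simp

lemma one_sub (k k' : α → ℚ) (w : List α) :
    one (fun s => k s - k' s) w = one k w - one k' w := by
  rcases w with _ | ⟨s, _ | ⟨t, w⟩⟩ <;> simp

lemma one_mul_left (r : ℚ) (k : α → ℚ) (w : List α) :
    one (fun s => r * k s) w = r * one k w := by
  rcases w with _ | ⟨s, _ | ⟨t, w⟩⟩ <;> simp

lemma one_map (f : β → α) (k : α → ℚ) (w : List β) :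
    one k (w.map f) = one (fun s => k (f s)) w := by
  rcases w with _ | ⟨s, _ | ⟨t, w⟩⟩ <;> simp

lemma one_conv (K : α → List β → List β → ℚ) (v : List β) (w : List α) :
    one (fun s => conv (K s) v) w = conv (fun x y => one (fun s => K s x y) w) v := by
  rcases w with _ | ⟨s, _ | ⟨t, w⟩⟩ <;> simp [conv_zero]

end Conv

/-! ### The derivation on functions of words -/

/-- The total weight of a word. -/
def wt {X : Type} (w : List (X × ℚ)) : ℚ := (w.map Prod.snd).sum

/-- Translation of the group components of a word. -/
def tr (g : Γ) (w : List (Γ × ℚ)) : List (Γ × ℚ) := w.map fun s => (s.1 * g, s.2)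

@[simp] lemma wt_nil {X : Type} : wt ([] : List (X × ℚ)) = 0 := rfl

@[simp] lemma wt_cons {X : Type} (s : X × ℚ) (w : List (X × ℚ)) : wt (s :: w) = s.2 + wt w := by
  simp [wt]

@[simp] lemma wt_append {X : Type} (u v : List (X × ℚ)) : wt (u ++ v) = wt u + wt v := by
  simp [wt]

@[simp] lemma wt_tr (g : Γ) (w : List (Γ × ℚ)) : wt (tr g w) = wt w := by
  simp [wt, tr, Function.comp_def]

@[simp] lemma tr_nil (g : Γ) : tr g [] = [] := rfl

@[simp] lemma tr_cons (g : Γ) (s : Γ × ℚ) (w : List (Γ × ℚ)) :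
    tr g (s :: w) = (s.1 * g, s.2) :: tr g w := rfl

lemma tr_tr (g h : Γ) (w : List (Γ × ℚ)) : tr h (tr g w) = tr (g * h) w := by
  simp [tr, mul_assoc]

lemma conv_tr (g : Γ) (G : List (Γ × ℚ) → List (Γ × ℚ) → ℚ) (w : List (Γ × ℚ)) :
    conv G (tr g w) = conv (fun u c => G (tr g u) (tr g c)) w :=
  conv_map _ _ _

lemma one_tr (g : Γ) (k : Γ × ℚ → ℚ) (w : List (Γ × ℚ)) :
    one k (tr g w) = one (fun s => k (s.1 * g, s.2)) w :=
  one_map _ _ _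

/-- Contraction of a word into its last letter. -/
def insR (A : List (Γ × ℚ) → ℚ) (f : Γ × ℚ → ℚ) : List (Γ × ℚ) → ℚ :=
  conv fun u c => one (fun s => f (s.1, wt u + s.2) * A (tr s.1⁻¹ u)) c

/-- Contraction of a word into its first letter. -/
def insL (A : List (Γ × ℚ) → ℚ) (f : Γ × ℚ → ℚ) : List (Γ × ℚ) → ℚ :=
  conv fun u c => one (fun s => f (s.1, s.2 + wt c) * A (tr s.1⁻¹ c)) u

/-- Contraction of a word into an inner letter. -/
def mid (A B : List (Γ × ℚ) → ℚ) (f : Γ × ℚ → ℚ) : List (Γ × ℚ) → ℚ :=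
  conv fun u => conv fun t v =>
    one (fun s => f (s.1, wt u + s.2 + wt v) * (A (tr s.1⁻¹ u) * B (tr s.1⁻¹ v))) t

/-- Signed contraction of a word into its outer letters. -/
def ins (A : List (Γ × ℚ) → ℚ) (f : Γ × ℚ → ℚ) (w : List (Γ × ℚ)) : ℚ :=
  insR A f w - insL A f w

/-- The part of the derivation which contracts the prefixes of a word. -/
def pre (A F : List (Γ × ℚ) → ℚ) : List (Γ × ℚ) → ℚ :=
  conv fun u c => ins A (fun s => F (s :: c)) u

/-- The derivation `arit_u(A)` on functions of words. -/
def der (A : List (Γ × ℚ) → ℚ) : (List (Γ × ℚ) → ℚ) → List (Γ × ℚ) → ℚ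
  | _, [] => 0
  | F, a :: w => der A (fun v => F (a :: v)) w + pre A F (a :: w)

section Der

variable (A B F : List (Γ × ℚ) → ℚ) (f f' : Γ × ℚ → ℚ) (w : List (Γ × ℚ))

@[simp] lemma ins_nil : ins A f [] = 0 := by simp [ins, insR, insL]

@[simp] lemma pre_nil : pre A F [] = 0 := by simp [pre]

@[simp] lemma der_nil : der A F [] = 0 := by simp [der]

lemma der_cons (a : Γ × ℚ) :
    der A F (a :: w) = der A (fun v => F (a :: v)) w + pre A F (a :: w) := by simp [der]

lemma ins_add : ins A (fun s => f s + f' s) w = ins A f w + ins A f' w := by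
  simp only [ins, insR, insL, add_mul, one_add, conv_add]
  ring

lemma ins_mul_left (r : ℚ) : ins A (fun s => r * f s) w = r * ins A f w := by
  simp only [ins, insR, insL, mul_assoc, one_mul_left, conv_mul_left]
  ring

lemma ins_zero : ins A (fun _ => 0) w = 0 := by
  simpa using ins_mul_left A (fun _ => 0) w 0

lemma ins_conv {α : Type} (K : Γ × ℚ → List α → List α → ℚ) (v : List α) :
    ins A (fun s => conv (K s) v) w = conv (fun x y => ins A (fun s => K s x y) w) v := by
  simp only [ins, insR, insL, conv_sub]
  rw [conv_comm fun x y u c => one (fun s => K (s.1, wt u + s.2) x y * A (tr s.1⁻¹ u)) c,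
    conv_comm fun x y u c => one (fun s => K (s.1, s.2 + wt c) x y * A (tr s.1⁻¹ c)) u]
  congr 1 <;> refine conv_congr fun u c _ => ?_ <;> rw [← one_conv] <;>
    refine one_congr (fun s => ?_) _ <;> rw [mul_comm, ← conv_mul_left] <;> simp only [mul_comm]

lemma pre_add (G : List (Γ × ℚ) → ℚ) :
    pre A (fun v => F v + G v) w = pre A F w + pre A G w := by
  simp only [pre, ins_add, conv_add]

lemma der_add (G : List (Γ × ℚ) → ℚ) :
    der A (fun v => F v + G v) w = der A F w + der A G w := by
  induction w generalizing F G with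
  | nil => simp
  | cons a w ih => rw [der_cons, der_cons, der_cons, ih, pre_add]; ring

lemma der_mul_left (r : ℚ) : der A (fun v => r * F v) w = r * der A F w := by
  induction w generalizing F with
  | nil => simp
  | cons a w ih =>
    simp only [der_cons, ih, pre, ins_mul_left, conv_mul_left]
    ring

lemma der_sub (G : List (Γ × ℚ) → ℚ) :
    der A (fun v => F v - G v) w = der A F w - der A G w := by
  have := der_add A F w fun v => -1 * G v
  rw [der_mul_left] at this
  simpa [sub_eq_add_neg] using this

/-- A function supported on the empty word is killed by the derivation. -/
lemma der_eq_zero (h : ∀ s v, F (s :: v) = 0) : der A F w = 0 := by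
  induction w generalizing F with
  | nil => simp
  | cons a w ih =>
    rw [der_cons, ih _ fun s v => h a (s :: v)]
    simp [pre, h, ins_zero, conv_zero]

lemma der_one : der A (one f) w = ins A f w := by
  have h : pre A (one f) w = ins A f w := by
    rw [← conv_nil_right (ins A f) w]
    refine conv_congr fun u c _ => ?_
    rcases c with _ | ⟨t, c⟩ <;> simp [ins_zero]
  cases w with
  | nil => simp
  | cons a w =>
    rw [der_cons, h, der_eq_zero _ _ _ fun s v => by simp, zero_add]

/-- Leibniz rule. -/
lemma der_conv (G : List (Γ × ℚ) → List (Γ × ℚ) → ℚ) :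
    der A (conv G) w =
      conv (fun u c => der A (fun v => G v c) u + der A (G u) c) w := by
  induction w generalizing G with
  | nil => simp
  | cons a w ih =>
    have h : pre A (conv G) (a :: w) =
        pre A (G []) (a :: w) + conv (fun u c => pre A (fun v => G v c) u) (a :: w) := by
      simp only [pre, conv_assoc, ← ins_conv, conv_cons G, ins_add, conv_add]
    rw [der_cons, h]
    simp only [conv_cons, der_add, ih, der_nil, pre_nil, der_cons, conv_add]
    ring

lemma ins_tr_mul (g : Γ) (h : ℚ → ℚ) (r : ℚ) :
    ins A (fun s => h (s.2 + r) * f (s.1 * g, s.2)) w = h (wt w + r) * ins A f (tr g w) := by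
  have key : ∀ (s : Γ) (u : List (Γ × ℚ)), tr (s * g)⁻¹ (tr g u) = tr s⁻¹ u := fun s u => by
    rw [tr_tr]; congr 1; simp
  simp only [ins, mul_sub]
  congr 1
  · simp only [insR]
    rw [conv_tr, ← conv_mul_left]
    refine conv_congr fun u c huc => ?_
    rw [one_tr, ← one_mul_left]
    subst huc
    rcases c with _ | ⟨s, _ | ⟨t, c⟩⟩ <;>
      simp only [one_nil, one_singleton, one_cons_cons, wt_append, wt_cons, wt_nil, wt_tr, key,
        mul_assoc, add_zero]
  · simp only [insL]
    rw [conv_tr, ← conv_mul_left]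
    refine conv_congr fun u c huc => ?_
    rw [one_tr, ← one_mul_left]
    subst huc
    rcases u with _ | ⟨s, _ | ⟨t, u⟩⟩ <;>
      simp only [one_nil, one_singleton, one_cons_cons, wt_append, wt_cons, wt_nil, wt_tr, key,
        mul_assoc, add_zero]

lemma der_tr_mul (g : Γ) (h : ℚ → ℚ) :
    der A (fun v => h (wt v) * F (tr g v)) w = h (wt w) * der A F (tr g w) := by
  induction w generalizing F h with
  | nil => simp
  | cons a w ih =>
    have hp : ∀ w, pre A (fun v => h (wt v) * F (tr g v)) w = h (wt w) * pre A F (tr g w) := by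
      intro w
      simp only [pre]
      rw [conv_tr, ← conv_mul_left]
      refine conv_congr fun u c huc => ?_
      subst huc
      simpa using ins_tr_mul A (fun s => F (s :: tr g c)) u g h (wt c)
    have := ih (fun v => F ((a.1 * g, a.2) :: v)) (fun r => h (a.2 + r))
    simp only [der_cons, hp, wt_cons, tr_cons, mul_add] at this ⊢
    rw [this]

lemma der_const_one {α : Type} (K : List (Γ × ℚ) → α → ℚ) (c : List α) :
    der A (fun v => one (K v) c) w = one (fun s => der A (fun v => K v s) w) c := by
  rcases c with _ | ⟨s, _ | ⟨t, c⟩⟩ <;> simp [der_eq_zero]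

lemma der_conv_right {α : Type} (K : List (Γ × ℚ) → List α → List α → ℚ) (u : List α) :
    der A (fun v => conv (K v) u) w = conv (fun x y => der A (fun v => K v x y) w) u := by
  induction w generalizing K with
  | nil => simp [conv_zero]
  | cons a w ih =>
    simp only [der_cons, ih, pre, ins_conv, conv_add]
    rw [conv_comm]

/-- The product of functions of words. -/
def mul : List (Γ × ℚ) → ℚ := conv fun u c => A u * B c

lemma der_insR :
    der B (insR A f) w = insR (fun v => der B A v + mul A B v) f w - mid A B f w := by
  have h1 : conv (fun u c => der B (fun v => one (fun s => f (s.1, wt v + s.2) *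
      A (tr s.1⁻¹ v)) c) u) w = insR (der B A) f w := by
    refine conv_congr fun u c _ => ?_
    rw [der_const_one]
    exact one_congr (fun s => der_tr_mul B A u (s : Γ × ℚ).1⁻¹ fun r => f (s.1, r + s.2)) _
  have h2 : conv (fun u => insR B fun s => f (s.1, wt u + s.2) * A (tr s.1⁻¹ u)) w =
      insR (mul A B) f w := by
    simp only [insR]
    rw [← conv_assoc]
    refine conv_congr fun v t _ => ?_
    rw [← one_conv]
    refine one_congr (fun s => ?_) _
    rw [mul, conv_tr, ← conv_mul_left]
    refine conv_congr fun x y hxy => ?_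
    subst hxy
    simp [mul_assoc, add_assoc]
  have h3 : conv (fun u => insL B fun s => f (s.1, wt u + s.2) * A (tr s.1⁻¹ u)) w =
      mid A B f w := by
    simp only [insL, mid, mul_assoc, add_assoc]
  rw [insR, der_conv, conv_add, h1]
  have h4 : conv (fun u => der B fun c => one (fun s => f (s.1, wt u + s.2) *
      A (tr s.1⁻¹ u)) c) w = insR (mul A B) f w - mid A B f w := by
    rw [← h2, ← h3, ← conv_sub]
    exact conv_congr fun u c _ => der_one B _ c
  rw [h4]
  simp only [insR, mul_add, one_add, conv_add]
  ring

lemma der_insL :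
    der B (insL A f) w = insL (fun v => der B A v - mul B A v) f w + mid B A f w := by
  have h1 : conv (fun u c => der B (fun v => one (fun s => f (s.1, s.2 + wt v) *
      A (tr s.1⁻¹ v)) u) c) w = insL (der B A) f w := by
    refine conv_congr fun u c _ => ?_
    rw [der_const_one]
    exact one_congr (fun s => der_tr_mul B A c (s : Γ × ℚ).1⁻¹ fun r => f (s.1, s.2 + r)) _
  have h2 : conv (fun u c => insL B (fun s => f (s.1, s.2 + wt c) * A (tr s.1⁻¹ c)) u) w =
      insL (mul B A) f w := by
    simp only [insL]
    rw [conv_assoc]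
    refine conv_congr fun t v _ => ?_
    rw [← one_conv]
    refine one_congr (fun s => ?_) _
    rw [mul, conv_tr, ← conv_mul_left]
    refine conv_congr fun x y hxy => ?_
    subst hxy
    simp only [wt_append, add_assoc]
    ring
  have h3 : conv (fun u c => insR B (fun s => f (s.1, s.2 + wt c) * A (tr s.1⁻¹ c)) u) w =
      mid B A f w := by
    simp only [insR, mid]
    rw [conv_assoc]
    refine conv_congr fun x y _ => conv_congr fun t v _ => one_congr (fun s => ?_) _
    simp only [add_assoc]
    ring
  rw [insL, der_conv, conv_add, h1]
  simp only [der_one, ins, conv_sub]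
  rw [h2, h3]
  simp only [insL, mul_sub, one_sub, conv_sub]
  ring

/-- The bracket on functions of words. -/
def bracket (v : List (Γ × ℚ)) : ℚ := der B A v - der A B v + mul A B v - mul B A v

lemma der_ins_comm :
    der B (ins A f) w - der A (ins B f) w = ins (bracket A B) f w := by
  unfold ins bracket
  simp only [der_sub, der_insR, der_insL]
  simp only [insR, insL, mul_add, mul_sub, one_add, one_sub, conv_add, conv_sub]
  ring

lemma der_pre :
    der B (pre A F) w = conv (fun u c => der B (ins A fun s => F (s :: c)) u) w +
      conv (fun u c => ins A (fun s => der B (fun v => F (s :: v)) c) u) w := by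
  have h : ∀ u c, der B (fun v => ins A (fun s => F (s :: v)) u) c =
      ins A (fun s => der B (fun v => F (s :: v)) c) u := fun u c => by
    simp only [ins, insR, insL, der_sub, der_conv_right, der_const_one, mul_comm (F _),
      der_mul_left, mul_comm (der _ _ _)]
  simp only [pre, der_conv, conv_add, h]

lemma pre_der :
    pre B (der A F) w = conv (fun u c => ins B (fun s => der A (fun v => F (s :: v)) c) u) w +
      pre B (pre A F) w := by
  simp only [pre, der_cons, ins_add, conv_add]

theorem der_comm :
    der B (der A F) w - der A (der B F) w = der (bracket A B) F w := by
  induction w generalizing F with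
  | nil => simp
  | cons a w ih =>
    have h : ∀ A B : List (Γ × ℚ) → ℚ, der B (der A F) (a :: w) =
        der B (der A fun v => F (a :: v)) w +
        conv (fun u c => der B (ins A fun s => F (s :: c)) u) (a :: w) +
        conv (fun u c => ins A (fun s => der B (fun v => F (s :: v)) c) u) (a :: w) +
        conv (fun u c => ins B (fun s => der A (fun v => F (s :: v)) c) u) (a :: w) := by
      intro A B
      have h1 := der_pre A B F (a :: w)
      rw [der_cons] at h1 ⊢
      rw [pre_der]
      simp only [der_cons A F, der_add]
      linarith
    rw [h A B, h B A, der_cons, ← ih, pre]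
    simp only [← der_ins_comm, conv_sub]
    ring

end Der

/-! ### Moulds as functions on words -/

lemma conv_one_prefix {α : Type} (K : List α → List α → α → ℚ) (w : List α) :
    conv (fun a r => conv (fun t c => one (K a c) t) r) w =
      ∑ p ∈ Finset.range w.length,
        one (K (w.take p) (w.drop (p + 1))) ((w.drop p).take 1) := by
  have h : ∀ (k : List α → α → ℚ) (w : List α),
      conv (fun t c => one (k c) t) w = one (k (w.drop 1)) (w.take 1) := by
    intro k w
    rcases w with _ | ⟨a, _ | ⟨b, w⟩⟩
    · simp
    · simp [conv_cons]
    · simp [conv_cons, conv_zero]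
  simp only [h]
  simp only [conv, Finset.sum_range_succ, List.drop_length, List.drop_drop, List.take_nil, one_nil,
    add_zero]

lemma conv_assoc_last {α : Type} (K : List α → List α → List α → List α → ℚ) (w : List α) :
    conv (fun a => conv fun u c => conv (fun x y => K a x y c) u) w =
      conv (fun u => conv fun y c => conv (fun a x => K a x y c) u) w := by
  have h : ∀ a r, conv (fun u c => conv (fun x y => K a x y c) u) r =
      conv (fun x r => conv (fun y c => K a x y c) r) r := fun a => conv_assoc (K a)
  rw [conv_congr fun a r _ => h a r, ← conv_assoc fun a x r => conv (fun y c => K a x y c) r]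
  exact conv_congr fun u r _ => conv_comm _ _ _

lemma der_eq_conv (A F : List (Γ × ℚ) → ℚ) (w : List (Γ × ℚ)) :
    der A F w = conv (fun a r => pre A (fun v => F (a ++ v)) r) w := by
  induction w generalizing F with
  | nil => simp
  | cons a w ih => simp [der_cons, conv_cons, ih, add_comm]

lemma der_eq_sum (A F : List (Γ × ℚ) → ℚ) (w : List (Γ × ℚ)) :
    der A F w =
      (∑ p ∈ Finset.range w.length, ∑ k ∈ Finset.range (p + 1),
        one (fun s => F (w.take k ++ (s.1, wt ((w.take p).drop k) + s.2) :: w.drop (p + 1)) *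
          A (tr s.1⁻¹ ((w.take p).drop k))) ((w.drop p).take 1)) -
      ∑ p ∈ Finset.range w.length, ∑ i ∈ Finset.range (w.length - p - 1 + 1),
        one (fun s => F (w.take p ++ (s.1, s.2 + wt ((w.drop (p + 1)).take i)) ::
          w.drop (p + 1 + i)) * A (tr s.1⁻¹ ((w.drop (p + 1)).take i))) ((w.drop p).take 1) := by
  simp only [der_eq_conv, pre, ins, insR, insL, conv_sub]
  congr 1
  · rw [conv_assoc_last fun a x y c => one (fun s => F (a ++ (s.1, wt x + s.2) :: c) *
      A (tr s.1⁻¹ x)) y]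
    simp only [← one_conv]
    rw [conv_one_prefix]
    refine Finset.sum_congr rfl fun p hp => ?_
    have hp := Finset.mem_range.1 hp
    rw [one_conv, conv, List.length_take, min_eq_left hp.le]
    refine Finset.sum_congr rfl fun k hk => ?_
    rw [List.take_take, min_eq_left (Nat.lt_succ_iff.1 (Finset.mem_range.1 hk))]
  · have h : ∀ a r, conv (fun u c => conv (fun t v => one (fun s =>
        F (a ++ (s.1, s.2 + wt v) :: c) * A (tr s.1⁻¹ v)) t) u) r =
        conv (fun t r => one (fun s => conv (fun v c =>
          F (a ++ (s.1, s.2 + wt v) :: c) * A (tr s.1⁻¹ v)) r) t) r := fun a r => by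
      rw [conv_assoc fun t v c => one (fun s =>
        F (a ++ (s.1, s.2 + wt v) :: c) * A (tr s.1⁻¹ v)) t]
      simp only [one_conv]
    rw [conv_congr fun a r _ => h a r, conv_one_prefix]
    refine Finset.sum_congr rfl fun p hp => ?_
    rw [one_conv, conv]
    simp only [List.length_drop, List.drop_drop, Nat.sub_sub]

lemma sum_blocks_before (m : ℕ) (g h : ℕ → ℕ → ℚ) (h0 : ∀ p < m, h p p = 0)
    (hg : ∀ k l, k ≤ l → l + 1 < m → g k l = h k (l + 1)) :
    (∑ k ∈ Finset.range m, ∑ l ∈ Finset.range m, if k ≤ l ∧ l + 1 < m then g k l else 0) =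
      ∑ p ∈ Finset.range m, ∑ k ∈ Finset.range (p + 1), h k p := by
  cases m with
  | zero => simp
  | succ m =>
    rw [Finset.sum_comm, Finset.sum_range_succ,
      Finset.sum_range_succ' fun p => ∑ k ∈ Finset.range (p + 1), h k p]
    congr 1
    · refine Finset.sum_congr rfl fun l hl => ?_
      have hl := Finset.mem_range.1 hl
      rw [Finset.sum_range_succ _ (l + 1), h0 _ (by omega), add_zero, ← Finset.sum_filter]
      refine Finset.sum_congr ?_ fun k hk => hg k l ?_ (by omega)
      · ext k
        simp only [Finset.mem_filter, Finset.mem_range]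
        omega
      · exact Nat.lt_succ_iff.1 (Finset.mem_range.1 hk)
    · simp [h0]

lemma sum_blocks_after (m : ℕ) (g h : ℕ → ℕ → ℚ) (h0 : ∀ p < m, h p 0 = 0)
    (hg : ∀ p i, p + 1 + i < m → g (p + 1) (p + 1 + i) = h p (i + 1)) :
    (∑ k ∈ Finset.range m, ∑ l ∈ Finset.range m, if 1 ≤ k ∧ k ≤ l then g k l else 0) =
      ∑ p ∈ Finset.range m, ∑ i ∈ Finset.range (m - p - 1 + 1), h p i := by
  cases m with
  | zero => simp
  | succ m =>
    rw [Finset.sum_range_succ',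
      Finset.sum_range_succ fun p => ∑ i ∈ Finset.range (m + 1 - p - 1 + 1), h p i]
    congr 1
    · refine Finset.sum_congr rfl fun p hp => ?_
      have hp := Finset.mem_range.1 hp
      rw [show m + 1 - p - 1 + 1 = m - p + 1 by omega,
        Finset.sum_range_succ' (h p), h0 _ (by omega), add_zero,
        show m + 1 = p + 1 + (m - p) by omega, Finset.sum_range_add,
        Finset.sum_eq_zero, zero_add]
      · refine Finset.sum_congr rfl fun i hi => ?_
        have hi := Finset.mem_range.1 hi
        rw [if_pos (by omega), hg _ _ (by omega)]
      · intro l hl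
        have hl := Finset.mem_range.1 hl
        rw [if_neg (by omega)]
    · simp [h0]

/-- The function on words determined by a mould. -/
def ofMould {X : Type} (M : Mould X) (w : List (X × ℚ)) : ℚ :=
  M w.length (fun i => w[i].1) fun i => w[i].2

lemma apply_eq_ofMould {X : Type} (M : Mould X) {n : ℕ} (w : List (X × ℚ)) (hw : w.length = n)
    (σ : Fin n → X) (x : Fin n → ℚ)
    (h : ∀ j (hj : j < n) (hj' : j < w.length), σ ⟨j, hj⟩ = w[j].1 ∧ x ⟨j, hj⟩ = w[j].2) :
    M n σ x = ofMould M w := by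
  subst hw
  unfold ofMould
  congr 1 <;> funext j
  · exact (h j j.2 j.2).1
  · exact (h j j.2 j.2).2

lemma apply_eq_ofMould_append_cons {X : Type} (M : Mould X) {n : ℕ} (a b : List (X × ℚ)) (s : X × ℚ)
    (hn : a.length + 1 + b.length = n) (σ : Fin n → X) (x : Fin n → ℚ)
    (ha : ∀ j (hj : j < n) (h : j < a.length), σ ⟨j, hj⟩ = a[j].1 ∧ x ⟨j, hj⟩ = a[j].2)
    (hs : ∀ j (hj : j < n), j = a.length → σ ⟨j, hj⟩ = s.1 ∧ x ⟨j, hj⟩ = s.2)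
    (hb : ∀ i (hi : i < b.length) j (hj : j < n), j = a.length + 1 + i →
      σ ⟨j, hj⟩ = b[i].1 ∧ x ⟨j, hj⟩ = b[i].2) :
    M n σ x = ofMould M (a ++ s :: b) := by
  refine apply_eq_ofMould _ _ (by simp; omega) _ _ fun j hj hj' => ?_
  rcases lt_trichotomy j a.length with h | h | h
  · rw [List.getElem_append_left h]
    exact ha j hj h
  · subst h
    simpa using hs _ hj rfl
  · obtain ⟨i, rfl⟩ := Nat.exists_eq_add_of_lt h
    have := hb i (by omega) _ hj (by omega)
    rw [List.getElem_append_right (by omega)]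
    simpa [add_assoc] using this

lemma ofMould_nil {X : Type} {M : Mould X} (hM : IsARI M) : ofMould M [] = 0 := hM _ _

lemma wt_eq_sum_Ico {X : Type} (u : List (X × ℚ)) (y : ℕ → ℚ) (k : ℕ)
    (h : ∀ j (hj : j < u.length), y (k + j) = u[j].2) :
    wt u = ∑ i ∈ Finset.Ico k (k + u.length), y i := by
  induction u generalizing k with
  | nil => simp
  | cons a u ih =>
    rw [Finset.sum_eq_sum_Ico_succ_bot (by simp), wt_cons, ih (k + 1)]
    · have := h 0 (by simp)
      simp only [add_zero, List.getElem_cons_zero] at this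
      rw [this, List.length_cons, add_right_comm, add_assoc k]
    · intro j hj
      have := h (j + 1) (by simpa using hj)
      rwa [← add_assoc, add_right_comm, List.getElem_cons_succ] at this

lemma take_one_drop {α : Type} (w : List α) (p : ℕ) (hp : p < w.length) :
    (w.drop p).take 1 = [w[p]] := by
  rw [List.drop_eq_getElem_cons hp, List.take_succ_cons, List.take_zero]

lemma ofMould_mul (A B : Mould Γ) (w : List (Γ × ℚ)) :
    ofMould (mouldMul A B) w = mul (ofMould A) (ofMould B) w := by
  unfold ofMould mouldMul mul conv
  refine Finset.sum_congr rfl fun k hk => ?_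
  have hk := Finset.mem_range.1 hk
  congr 1
  · refine apply_eq_ofMould _ _ (by simp; omega) _ _ fun j hj hj' => ?_
    have : j < w.length := by omega
    simp [extG, extQ, this]
  · refine apply_eq_ofMould _ _ (by simp) _ _ fun j hj hj' => ?_
    have : k + j < w.length := by omega
    simp [extG, extQ, this]

lemma contraction_before (M : Mould Γ) (w : List (Γ × ℚ)) (k l : ℕ) (hkl : k ≤ l)
    (hl : l + 1 < w.length) :
    M (w.length - (l - k + 1))
      (fun j => if j.val < k then extG (fun i : Fin w.length => w[i].1) j.val
        else if j.val = k then extG (fun i : Fin w.length => w[i].1) (l + 1)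
        else extG (fun i : Fin w.length => w[i].1) (j.val + (l - k + 1)))
      (fun j => if j.val < k then extQ (fun i : Fin w.length => w[i].2) j.val
        else if j.val = k then ∑ i ∈ Finset.Icc k (l + 1), extQ (fun i : Fin w.length => w[i].2) i
        else extQ (fun i : Fin w.length => w[i].2) (j.val + (l - k + 1))) =
    ofMould M (w.take k ++
      (w[l + 1].1, wt ((w.take (l + 1)).drop k) + w[l + 1].2) :: w.drop (l + 1 + 1)) := by
  refine apply_eq_ofMould_append_cons _ _ _ _ (by simp; omega) _ _ ?_ ?_ ?_
  · intro j hj h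
    simp only [List.length_take] at h
    have h1 : j < w.length := by omega
    have h2 : j < k := by omega
    simp [h2, extG, extQ, h1]
  · intro j hj h
    have h1 : j = k := by simp at h; omega
    rw [wt_eq_sum_Ico _ (extQ fun i : Fin w.length => w[i].2) k]
    · have h2 : k + ((w.take (l + 1)).drop k).length = l + 1 := by simp; omega
      rw [h2, ← Finset.Ico_add_one_right_eq_Icc, Finset.sum_Ico_succ_top (b := l + 1) (by omega)]
      simp [h1, extG, extQ, hl]
    · intro j hj
      have : k + j < w.length := by simp at hj; omega
      simp [extQ, this]
  · intro i hi j hj h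
    simp only [List.length_drop] at hi
    have h1 : j = k + 1 + i := by simp at h; omega
    have h2 : j + (l - k + 1) = l + 1 + 1 + i := by omega
    have h3 : l + 1 + 1 + i < w.length := by omega
    have h4 : ¬ j < k := by omega
    have h5 : ¬ j = k := by omega
    simp [h2, h3, h4, h5, extG, extQ]

lemma contraction_after (M : Mould Γ) (w : List (Γ × ℚ)) (p i : ℕ) (hpi : p + 1 + i < w.length) :
    M (w.length - (p + 1 + i - (p + 1) + 1))
      (fun j => if j.val < p + 1 - 1 then extG (fun i : Fin w.length => w[i].1) j.val
        else if j.val = p + 1 - 1 then extG (fun i : Fin w.length => w[i].1) (p + 1 - 1)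
        else extG (fun i : Fin w.length => w[i].1) (j.val + (p + 1 + i - (p + 1) + 1)))
      (fun j => if j.val < p + 1 - 1 then extQ (fun i : Fin w.length => w[i].2) j.val
        else if j.val = p + 1 - 1 then
          ∑ i ∈ Finset.Icc (p + 1 - 1) (p + 1 + i), extQ (fun i : Fin w.length => w[i].2) i
        else extQ (fun i : Fin w.length => w[i].2) (j.val + (p + 1 + i - (p + 1) + 1))) =
    ofMould M (w.take p ++
      (w[p].1, w[p].2 + wt ((w.drop (p + 1)).take (i + 1))) :: w.drop (p + 1 + (i + 1))) := by
  have hp : p < w.length := by omega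
  refine apply_eq_ofMould_append_cons _ _ _ _ (by simp; omega) _ _ ?_ ?_ ?_
  · intro j hj h
    simp only [List.length_take] at h
    have h1 : j < w.length := by omega
    have h2 : j < p := by omega
    simp [h2, extG, extQ, h1]
  · intro j hj h
    have h1 : j = p := by simp at h; omega
    rw [wt_eq_sum_Ico _ (extQ fun i : Fin w.length => w[i].2) (p + 1)]
    · have h2 : p + 1 + ((w.drop (p + 1)).take (i + 1)).length = p + 1 + i + 1 := by
        simp; omega
      rw [h2, ← Finset.Ico_add_one_right_eq_Icc,
        Finset.sum_eq_sum_Ico_succ_bot (a := p + 1 - 1) (by omega)]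
      simp [h1, extG, extQ, hp]
    · intro j hj
      have : p + 1 + j < w.length := by simp at hj; omega
      simp [extQ, this]
  · intro q hq j hj h
    simp only [List.length_drop] at hq
    have h1 : j = p + 1 + q := by simp at h; omega
    have h2 : j + (p + 1 + i - (p + 1) + 1) = p + 1 + (i + 1) + q := by omega
    have h3 : p + 1 + (i + 1) + q < w.length := by omega
    have h4 : ¬ j < p + 1 - 1 := by omega
    have h5 : ¬ j = p + 1 - 1 := by omega
    simp only [h2, h4, h5, extG, extQ, h3]
    simp

set_option maxHeartbeats 1000000 in
lemma ofMould_aritU (A B : Mould Γ) (hB : ofMould B [] = 0) (w : List (Γ × ℚ)) :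
    ofMould (aritU B A) w = der (ofMould B) (ofMould A) w := by
  rw [der_eq_sum, ofMould, aritU]
  refine congrArg₂ (· - ·) ?_ ?_
  · refine sum_blocks_before _ _ (fun k p => one (fun s => ofMould A (w.take k ++
      (s.1, wt ((w.take p).drop k) + s.2) :: w.drop (p + 1)) *
        ofMould B (tr s.1⁻¹ ((w.take p).drop k))) ((w.drop p).take 1)) ?_ ?_
    · intro p hp
      simp [take_one_drop w p hp, hB]
    · intro k l hkl hl
      rw [take_one_drop w _ hl, one_singleton]
      refine congrArg₂ (· * ·) ?_ ?_
      · exact contraction_before A w k l hkl hl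
      · refine apply_eq_ofMould _ _ (by simp [tr]; omega) _ _ fun j hj hj' => ?_
        have : k + j < w.length := by omega
        simp [tr, extG, extQ, this, hl]
  · refine sum_blocks_after _ _ (fun p i => one (fun s => ofMould A (w.take p ++
      (s.1, s.2 + wt ((w.drop (p + 1)).take i)) :: w.drop (p + 1 + i)) *
        ofMould B (tr s.1⁻¹ ((w.drop (p + 1)).take i))) ((w.drop p).take 1)) ?_ ?_
    · intro p hp
      simp [take_one_drop w p hp, hB]
    · intro p i hpi
      have hp : p < w.length := by omega
      rw [take_one_drop w p hp, one_singleton]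
      refine congrArg₂ (· * ·) ?_ ?_
      · exact contraction_after A w p i hpi
      · refine apply_eq_ofMould _ _ (by simp [tr]; omega) _ _ fun j hj hj' => ?_
        have : p + 1 + j < w.length := by omega
        simp [tr, extG, extQ, this, hp]

lemma ext_ofMould {X : Type} {M N : Mould X} (h : ∀ w, ofMould M w = ofMould N w) : M = N := by
  funext m σ x
  have key (M : Mould X) : M m σ x = ofMould M (List.ofFn fun i => (σ i, x i)) :=
    apply_eq_ofMould _ _ (by simp) _ _ (by simp)
  rw [key M, key N, h]

lemma ofMould_ariU (A B : Mould Γ) (hA : ofMould A [] = 0) (hB : ofMould B [] = 0)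
    (w : List (Γ × ℚ)) : ofMould (ariU A B) w = bracket (ofMould A) (ofMould B) w := by
  rw [bracket, ← ofMould_aritU _ _ hA, ← ofMould_aritU _ _ hB, ← ofMould_mul, ← ofMould_mul]
  rfl

/-- Proposition: `arit_u(B) ∘ arit_u(A) − arit_u(A) ∘ arit_u(B)
= arit_u(ari_u(A,B))` on `ARI(Γ)`. -/
theorem aritU_commutator (Γ : Type) [CommGroup Γ] [Fintype Γ]
    (A B C : Mould Γ) (hA : IsARI A) (hB : IsARI B) (hC : IsARI C) :
    aritU B (aritU A C) - aritU A (aritU B C) = aritU (ariU A B) C := by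
  have hA := ofMould_nil hA
  have hB := ofMould_nil hB
  have hAB := ofMould_ariU A B hA hB
  refine ext_ofMould fun w => ?_
  rw [ofMould_aritU _ _ (by simp [hAB, bracket, mul, hA, hB]), funext hAB, ← der_comm,
    ← funext (ofMould_aritU C A hA), ← funext (ofMould_aritU C B hB), ← ofMould_aritU _ _ hA,
    ← ofMould_aritU _ _ hB]
  rfl

end KVMould
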